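/- arXiv:1508.06188 — 8 statements merged into one kernel-verified Lean document; each statement's English description precedes it below -/
import Mathlib

section
/- Let n ≥ 1 and k = 2n. If A ∈ M_k(ℂ) satisfies Aᵀ J_k A = J_k (i.e., A is symplectic with respect to J_k), then for every pair of subsets S, T ⊆ {1,…,k} of the same cardinality, the minors satisfy A_{S,T} = A_{ι(S̄), ι(T̄)}. -/
open Matrix

/-- The antidiagonal matrix `J_k` with `(J_k)_{i, k+1-i} = (-1)^(i-1)` (1-indexed),
i.e. in 0-indexed terms the `(i,j)` entry is `(-1)^i` when `i + j + 1 = k` and `0` otherwise. -/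
noncomputable def Jmat (k : ℕ) : Matrix (Fin k) (Fin k) ℂ :=
  Matrix.of fun i j => if (i : ℕ) + (j : ℕ) + 1 = k then (-1 : ℂ) ^ (i : ℕ) else 0

/-- The minor `A_{S,T}` of a square matrix `A` with row indices in `S` and column
indices in `T`, both taken in increasing order (defined to be `0` if the cardinalities
of `S` and `T` differ). -/
noncomputable def gminor {k : ℕ} (A : Matrix (Fin k) (Fin k) ℂ)
    (S T : Finset (Fin k)) : ℂ :=
  if h : T.card = S.card then
    Matrix.det (Matrix.of fun i j : Fin S.card =>
      A (S.orderIsoOfFin rfl i) (T.orderIsoOfFin h j))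
  else 0

section Permutations

open Equiv Finset

/-- Swapping the consecutive elements `y < x` preserves the order on a set not containing both. -/
lemma Finset.swap_comp_orderEmbOfFin {k m : ℕ} {x y : Fin k} (hxy : (y : ℕ) + 1 = x)
    {S S' : Finset (Fin k)} (h : ¬ (x ∈ S ∧ y ∈ S)) (hS' : ∀ z, z ∈ S → swap y x z ∈ S')
    (hm : #S = m) (hm' : #S' = m) (i : Fin m) :
    S'.orderEmbOfFin hm' i = swap y x (S.orderEmbOfFin hm i) := by
  have hlt : ∀ a ∈ S, ∀ b ∈ S, a < b → swap y x a < swap y x b := by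
    intro a ha b hb hab
    simp only [swap_apply_def]
    split_ifs <;> grind
  have hmono : StrictMono fun i => swap y x (S.orderEmbOfFin hm i) := fun i j hij =>
    hlt _ (S.orderEmbOfFin_mem hm i) _ (S.orderEmbOfFin_mem hm j)
      ((S.orderEmbOfFin hm).strictMono hij)
  exact (congrFun
    (orderEmbOfFin_unique hm' (fun i => hS' _ (S.orderEmbOfFin_mem hm i)) hmono) i).symm

lemma finSumEquivOfFinset_map_swap {k m l : ℕ} {x y : Fin k} (hxy : (y : ℕ) + 1 = x)
    {S : Finset (Fin k)} (hx : x ∈ S) (hy : y ∉ S) (hm : #S = m) (hl : #Sᶜ = l)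
    (hm' : #(S.map (swap y x).toEmbedding) = m) (hl' : #(S.map (swap y x).toEmbedding)ᶜ = l) :
    finSumEquivOfFinset hm' hl' = (finSumEquivOfFinset hm hl).trans (swap y x) := by
  ext i : 1
  rcases i with i | i
  · exact swap_comp_orderEmbOfFin hxy (fun h => hy h.2) (fun z hz => by simpa using hz) hm hm' i
  · exact swap_comp_orderEmbOfFin hxy (fun h => by simp [hx] at h)
      (fun z hz => by simpa using hz) hl hl' i

lemma Finset.sum_val_map_swap {k : ℕ} {x y : Fin k} (hxy : (y : ℕ) + 1 = x)
    {S : Finset (Fin k)} (hx : x ∈ S) (hy : y ∉ S) :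
    ∑ i ∈ S, (i : ℕ) = ∑ i ∈ S.map (swap y x).toEmbedding, (i : ℕ) + 1 := by
  rw [sum_map, ← add_sum_erase S _ hx, ← add_sum_erase S _ hx]
  have : ∑ i ∈ S.erase x, ((swap y x i : Fin k) : ℕ) = ∑ i ∈ S.erase x, (i : ℕ) := by
    refine sum_congr rfl fun i hi => ?_
    rw [swap_apply_of_ne_of_ne] <;> grind
  simp [this]
  omega

lemma Finset.exists_succ_mem_notMem_of_not_isLowerSet {k : ℕ} {S : Finset (Fin k)}
    (h : ¬ IsLowerSet (S : Set (Fin k))) : ∃ x ∈ S, ∃ y ∉ S, (y : ℕ) + 1 = x := by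
  by_contra! H
  refine h ?_
  have key : ∀ d : ℕ, ∀ a b : Fin k, (b : ℕ) + d = a → a ∈ S → b ∈ S := by
    intro d
    induction d with
    | zero => intro a b hab ha; rwa [Fin.ext (a := b) (b := a) (by omega)]
    | succ d ih =>
      intro a b hab ha
      have hlt : (b : ℕ) + d < k := by omega
      refine ih ⟨b + d, hlt⟩ b rfl ?_
      by_contra hc
      exact H a ha _ hc (by simp; omega)
  intro a b hba ha
  exact key (a - b) a b (by have : (b : ℕ) ≤ a := hba; omega) ha

/-- The sign of the permutation mapping `T` to `S` and `Tᶜ` to `Sᶜ` increasingly. -/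
lemma sign_finSumEquivOfFinset {k m l : ℕ} {S T : Finset (Fin k)} (hS : #S = m) (hS' : #Sᶜ = l)
    (hT : #T = m) (hT' : #Tᶜ = l) :
    Perm.sign ((finSumEquivOfFinset hT hT').symm.trans (finSumEquivOfFinset hS hS')) =
      (-1) ^ (∑ i ∈ S, (i : ℕ) + ∑ i ∈ T, (i : ℕ)) := by
  induction hN : ∑ i ∈ S, (i : ℕ) + ∑ i ∈ T, (i : ℕ) using Nat.strong_induction_on
    generalizing S T with
  | _ N ih =>
  by_cases hSl : IsLowerSet (S : Set (Fin k))
  · by_cases hTl : IsLowerSet (T : Set (Fin k))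
    · obtain rfl : S = T := by
        rcases hSl.total hTl with h | h
        · exact eq_of_subset_of_card_le (coe_subset.1 h) (by rw [hS, hT])
        · exact (eq_of_subset_of_card_le (coe_subset.1 h) (by rw [hS, hT])).symm
      rw [← hN, Even.neg_one_pow ⟨_, rfl⟩]
      simp [← Perm.one_def]
    · obtain ⟨x, hx, y, hy, hxy⟩ := exists_succ_mem_notMem_of_not_isLowerSet hTl
      have hyx : y ≠ x := fun h => hy (h ▸ hx)
      have hsum := sum_val_map_swap hxy hx hy
      have hm' : #(T.map (swap y x).toEmbedding) = m := by rw [card_map, hT]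
      have hl' : #(T.map (swap y x).toEmbedding)ᶜ = l := by
        rw [card_compl, hm', ← hT', card_compl, hT]
      have key := ih _ (by omega) hS hS' hm' hl' rfl
      rw [finSumEquivOfFinset_map_swap hxy hx hy hT hT' hm' hl', symm_trans, trans_assoc,
        Perm.sign_trans, Perm.sign_symm, Perm.sign_swap hyx] at key
      rw [← hN, hsum, ← add_assoc, pow_succ, ← key]
      simp
  · obtain ⟨x, hx, y, hy, hxy⟩ := exists_succ_mem_notMem_of_not_isLowerSet hSl
    have hyx : y ≠ x := fun h => hy (h ▸ hx)
    have hsum := sum_val_map_swap hxy hx hy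
    have hm' : #(S.map (swap y x).toEmbedding) = m := by rw [card_map, hS]
    have hl' : #(S.map (swap y x).toEmbedding)ᶜ = l := by
      rw [card_compl, hm', ← hS', card_compl, hS]
    have key := ih _ (by omega) hm' hl' hT hT' rfl
    rw [finSumEquivOfFinset_map_swap hxy hx hy hS hS' hm' hl', ← trans_assoc,
      Perm.sign_trans, Perm.sign_swap hyx] at key
    rw [← hN, hsum, add_right_comm, pow_succ, ← key]
    simp

end Permutations

section Minors

variable {R : Type*} [CommRing R]

/-- Jacobi's complementary minor identity for block matrices. -/
lemma Matrix.det_toBlocks₁₁_of_mul_eq_one {m l : Type*} [Fintype m] [DecidableEq m] [Fintype l]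
    [DecidableEq l] {M N : Matrix (m ⊕ l) (m ⊕ l) R} (h : M * N = 1) :
    M.toBlocks₁₁.det = M.det * N.toBlocks₂₂.det := by
  have h' := h
  rw [← fromBlocks_toBlocks M, ← fromBlocks_toBlocks N, fromBlocks_multiply, ← fromBlocks_one,
    fromBlocks_inj] at h'
  have key : M * fromBlocks 1 N.toBlocks₁₂ 0 N.toBlocks₂₂ =
      fromBlocks M.toBlocks₁₁ 0 M.toBlocks₂₁ 1 := by
    conv_lhs => rw [← fromBlocks_toBlocks M]
    rw [fromBlocks_multiply, h'.2.1, h'.2.2.2]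
    simp
  simpa using (congrArg det key).symm

/-- Jacobi's complementary minor identity. -/
lemma Matrix.det_submatrix_orderEmbOfFin {k m l : ℕ} {A B : Matrix (Fin k) (Fin k) R}
    (h : A * B = 1) {S T : Finset (Fin k)} (hS : S.card = m) (hS' : Sᶜ.card = l)
    (hT : T.card = m) (hT' : Tᶜ.card = l) :
    (A.submatrix (S.orderEmbOfFin hS) (T.orderEmbOfFin hT)).det =
      (-1) ^ (∑ i ∈ S, (i : ℕ) + ∑ i ∈ T, (i : ℕ)) * A.det *
        (B.submatrix (Tᶜ.orderEmbOfFin hT') (Sᶜ.orderEmbOfFin hS')).det := by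
  have hmul : A.submatrix (finSumEquivOfFinset hS hS') (finSumEquivOfFinset hT hT') *
      B.submatrix (finSumEquivOfFinset hT hT') (finSumEquivOfFinset hS hS') = 1 := by
    rw [submatrix_mul_equiv, h, submatrix_one_equiv]
  have hdet : (A.submatrix (finSumEquivOfFinset hS hS') (finSumEquivOfFinset hT hT')).det =
      (-1) ^ (∑ i ∈ S, (i : ℕ) + ∑ i ∈ T, (i : ℕ)) * A.det := by
    rw [← det_submatrix_equiv_self (finSumEquivOfFinset hT hT').symm, submatrix_submatrix,
      Equiv.self_comp_symm]
    have := det_permute ((finSumEquivOfFinset hT hT').symm.trans (finSumEquivOfFinset hS hS')) A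
    rw [sign_finSumEquivOfFinset] at this
    simpa using this
  rw [← hdet]
  exact det_toBlocks₁₁_of_mul_eq_one hmul

end Minors

section Symplectic

lemma neg_one_pow_eq_neg_of_odd_add {a b : ℕ} (h : Odd (a + b)) :
    (-1 : ℂ) ^ a = -(-1) ^ b := by
  rw [show -(-1 : ℂ) ^ b = (-1) ^ (b + 1) by ring]
  exact neg_one_pow_congr (by grind)

lemma Jmat_mul_apply {n : ℕ} (M : Matrix (Fin (2 * n)) (Fin (2 * n)) ℂ) (i j : Fin (2 * n)) :
    (Jmat (2 * n) * M) i j = (-1) ^ (i : ℕ) * M i.rev j := by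
  rw [mul_apply, Finset.sum_eq_single i.rev]
  · simp only [Jmat, of_apply, Fin.val_rev]
    rw [if_pos (by omega)]
  · intro b _ hb
    simp only [Jmat, of_apply]
    rw [if_neg, zero_mul]
    intro h
    exact hb (Fin.ext (by rw [Fin.val_rev]; omega))
  · simp

lemma mul_Jmat_apply {n : ℕ} (M : Matrix (Fin (2 * n)) (Fin (2 * n)) ℂ) (i j : Fin (2 * n)) :
    (M * Jmat (2 * n)) i j = -(-1) ^ (j : ℕ) * M i j.rev := by
  rw [mul_apply, Finset.sum_eq_single j.rev]
  · simp only [Jmat, of_apply, Fin.val_rev]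
    rw [if_pos (by omega), mul_comm]
    congr 1
    exact neg_one_pow_eq_neg_of_odd_add ⟨n - 1, by omega⟩
  · intro b _ hb
    simp only [Jmat, of_apply]
    rw [if_neg, mul_zero]
    intro h
    exact hb (Fin.ext (by rw [Fin.val_rev]; omega))
  · simp

lemma Jmat_mul_self (n : ℕ) : Jmat (2 * n) * Jmat (2 * n) = -1 := by
  ext i j
  rw [Jmat_mul_apply, Jmat, of_apply, neg_apply, one_apply]
  by_cases h : i = j
  · subst h
    rw [if_pos (by rw [Fin.val_rev]; omega), if_pos rfl, ← pow_add, Odd.neg_one_pow]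
    rw [Fin.val_rev]
    grind
  · rw [if_neg (by rw [Fin.val_rev]; omega), if_neg h]
    simp

/-- A matrix symplectic with respect to `J_{2n}` has determinant one. -/
lemma det_eq_one_of_transpose_mul_Jmat_mul {n : ℕ} {A : Matrix (Fin (2 * n)) (Fin (2 * n)) ℂ}
    (hA : Aᵀ * Jmat (2 * n) * A = Jmat (2 * n)) : A.det = 1 := by
  let e : Fin n ⊕ Fin n ≃ Fin (2 * n) :=
    ((Equiv.sumCongr (Equiv.refl _) Fin.revPerm).trans finSumFinEquiv).trans
      (finCongr (two_mul n).symm)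
  let D : Matrix (Fin n) (Fin n) ℂ := diagonal fun i => (-1) ^ (i : ℕ)
  have hD : D * D = 1 := by
    simp only [D, diagonal_mul_diagonal, ← mul_pow]
    simp
  let E : Matrix (Fin n ⊕ Fin n) (Fin n ⊕ Fin n) ℂ := fromBlocks (-D) 0 0 1
  have hE : E * E = 1 := by simp [E, fromBlocks_multiply, hD]
  have hET : Eᵀ = E := by simp [E, D, fromBlocks_transpose]
  have hJ : (Jmat (2 * n)).submatrix e e = E * J (Fin n) ℂ * E := by
    simp only [E, J, fromBlocks_multiply]
    ext i j
    rcases i with i | i <;> rcases j with j | j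
    · simp [e, Jmat]
      omega
    · rcases eq_or_ne i j with rfl | h
      · simp [e, Jmat, D]
        omega
      · simp [e, Jmat, D, h]
        omega
    · rcases eq_or_ne i j with rfl | h
      · simp [e, Jmat, D]
        rw [if_pos (by omega)]
        exact neg_one_pow_eq_neg_of_odd_add ⟨n - 1, by omega⟩
      · simp [e, Jmat, D, h]
        omega
    · simp [e, Jmat]
      omega
  set M := A.submatrix e e with hM
  have hMJ : Mᵀ * (E * J (Fin n) ℂ * E) * M = E * J (Fin n) ℂ * E := by
    rw [← hJ, hM, transpose_submatrix, submatrix_mul_equiv, submatrix_mul_equiv, hA]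
  have hmem : E * M * E ∈ symplecticGroup (Fin n) ℂ := by
    rw [SymplecticGroup.mem_iff', transpose_mul, transpose_mul, hET]
    calc E * (Mᵀ * E) * J (Fin n) ℂ * (E * M * E)
        = E * (Mᵀ * (E * J (Fin n) ℂ * E) * M) * E := by simp only [Matrix.mul_assoc]
      _ = (E * E) * J (Fin n) ℂ * (E * E) := by rw [hMJ]; simp only [Matrix.mul_assoc]
      _ = J (Fin n) ℂ := by simp [hE]
  have hdet := SymplecticGroup.det_eq_one hmem
  have hEdet : E.det * E.det = 1 := by rw [← det_mul, hE, det_one]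
  rw [det_mul, det_mul, mul_right_comm, hEdet, one_mul, hM, det_submatrix_equiv_self] at hdet
  exact hdet

lemma mul_signed_rev_transpose_eq_one {n : ℕ} {A : Matrix (Fin (2 * n)) (Fin (2 * n)) ℂ}
    (hA : Aᵀ * Jmat (2 * n) * A = Jmat (2 * n)) :
    A * of (fun i j : Fin (2 * n) => (-1 : ℂ) ^ (i : ℕ) * (-1) ^ (j : ℕ) * A j.rev i.rev) = 1 := by
  have hB : of (fun i j : Fin (2 * n) => (-1 : ℂ) ^ (i : ℕ) * (-1) ^ (j : ℕ) * A j.rev i.rev) =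
      -(Jmat (2 * n) * (Aᵀ * Jmat (2 * n))) := by
    ext i j
    rw [neg_apply, Jmat_mul_apply, mul_Jmat_apply, of_apply, transpose_apply]
    ring
  rw [mul_eq_one_comm, hB, Matrix.neg_mul, Matrix.mul_assoc, hA, Jmat_mul_self, neg_neg]

lemma gminor_eq_det_submatrix {k m : ℕ} (A : Matrix (Fin k) (Fin k) ℂ) {S T : Finset (Fin k)}
    (hS : S.card = m) (hT : T.card = m) :
    gminor A S T = (A.submatrix (S.orderEmbOfFin hS) (T.orderEmbOfFin hT)).det := by
  subst hS
  rw [gminor, dif_pos hT]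
  rfl

lemma Finset.orderEmbOfFin_image_rev {k m : ℕ} {S : Finset (Fin k)} (hS : S.card = m)
    (hS' : (S.image Fin.rev).card = m) (i : Fin m) :
    (S.image Fin.rev).orderEmbOfFin hS' i = (S.orderEmbOfFin hS i.rev).rev := by
  refine (congrFun (orderEmbOfFin_unique hS' (f := fun i => (S.orderEmbOfFin hS i.rev).rev)
    (fun i => mem_image_of_mem _ (S.orderEmbOfFin_mem hS _)) fun i j hij => ?_) i).symm
  simpa using hij

lemma gminor_image_rev {k m : ℕ} (A : Matrix (Fin k) (Fin k) ℂ) {S T : Finset (Fin k)}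
    (hS : S.card = m) (hT : T.card = m) :
    gminor A (S.image Fin.rev) (T.image Fin.rev) =
      ((A.submatrix Fin.rev Fin.rev).submatrix (S.orderEmbOfFin hS) (T.orderEmbOfFin hT)).det := by
  have hS' : (S.image Fin.rev).card = m := by
    rw [Finset.card_image_of_injective _ Fin.rev_injective, hS]
  have hT' : (T.image Fin.rev).card = m := by
    rw [Finset.card_image_of_injective _ Fin.rev_injective, hT]
  rw [gminor_eq_det_submatrix A hS' hT', ← det_submatrix_equiv_self Fin.revPerm]
  congr 1
  ext i j
  simp [Finset.orderEmbOfFin_image_rev hS, Finset.orderEmbOfFin_image_rev hT]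

lemma Finset.prod_orderEmbOfFin {k m : ℕ} {S : Finset (Fin k)} (hS : S.card = m) :
    ∏ i, (-1 : ℂ) ^ (S.orderEmbOfFin hS i : ℕ) = (-1) ^ ∑ i ∈ S, (i : ℕ) := by
  rw [prod_pow_eq_pow_sum]
  conv_rhs => rw [← map_orderEmbOfFin_univ S hS, sum_map]
  rfl

end Symplectic

/-- if `A` is symplectic with respect to `J_{2n}`, then for all index sets
`S`, `T` of equal cardinality, `A_{S,T} = A_{ι(S̄), ι(T̄)}`, where `ι` is the index
inversion (`Fin.rev`) and the bar denotes complement. -/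
theorem symplectic_minor_identity (n : ℕ) (hn : 1 ≤ n)
    (A : Matrix (Fin (2 * n)) (Fin (2 * n)) ℂ)
    (hA : Aᵀ * Jmat (2 * n) * A = Jmat (2 * n))
    (S T : Finset (Fin (2 * n))) (hST : S.card = T.card) :
    gminor A S T = gminor A (Sᶜ.image Fin.rev) (Tᶜ.image Fin.rev) := by
  have hS' : Sᶜ.card = Tᶜ.card := by rw [Finset.card_compl, Finset.card_compl, hST]
  rw [gminor_eq_det_submatrix A hST rfl, gminor_image_rev A hS' rfl,
    det_submatrix_orderEmbOfFin (mul_signed_rev_transpose_eq_one hA) hST hS' rfl rfl,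
    det_eq_one_of_transpose_mul_Jmat_mul hA, mul_one]
  set C := (A.submatrix Fin.rev Fin.rev).submatrix (Sᶜ.orderEmbOfFin hS') (Tᶜ.orderEmbOfFin rfl)
    with hC
  have hB : (of fun i j : Fin (2 * n) =>
      (-1 : ℂ) ^ (i : ℕ) * (-1) ^ (j : ℕ) * A j.rev i.rev).submatrix
      (Tᶜ.orderEmbOfFin rfl) (Sᶜ.orderEmbOfFin hS') =
      diagonal (fun i => (-1) ^ (Tᶜ.orderEmbOfFin rfl i : ℕ)) * Cᵀ *
        diagonal (fun i => (-1) ^ (Sᶜ.orderEmbOfFin hS' i : ℕ)) := by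
    ext i j
    rw [mul_diagonal, diagonal_mul]
    simp only [hC, submatrix_apply, of_apply, transpose_apply]
    ring
  rw [hB, det_mul, det_mul, det_diagonal, det_diagonal, det_transpose,
    Finset.prod_orderEmbOfFin, Finset.prod_orderEmbOfFin]
  have hsign : (-1 : ℂ) ^ (∑ i ∈ S, (i : ℕ) + ∑ i ∈ T, (i : ℕ)) *
      ((-1) ^ (∑ i ∈ Tᶜ, (i : ℕ)) * (-1) ^ (∑ i ∈ Sᶜ, (i : ℕ))) = 1 := by
    rw [← pow_add, ← pow_add]
    refine Even.neg_one_pow ?_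
    have h1 := Finset.sum_add_sum_compl S fun i => (i : ℕ)
    have h2 := Finset.sum_add_sum_compl T fun i => (i : ℕ)
    grind
  linear_combination C.det * hsign
end

section
/- Let k ≥ 1, let I ⊆ ℝ be a nonempty open interval, and let ν : I → ℂ^k be k times differentiable. Suppose that for all 0 ≤ i, j ≤ k-1: (ν^{(i)})ᵀ J_k ν^{(j)} = 0 identically on I whenever i + j < k - 1, and (ν^{(i)})ᵀ J_k ν^{(j)} = (-1)^i identically on I whenever i + j = k - 1. Then (ν^{(i)})ᵀ J_k ν^{(j)} = 0 identically on I for all 0 ≤ i, j ≤ k with i + j = k. -/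
open Matrix

theorem HasDerivAt.dotProduct_mulVec {m n : Type*} [Fintype m] [Fintype n]
    {M : Matrix m n ℂ} {u : ℝ → m → ℂ} {v : ℝ → n → ℂ} {u' : m → ℂ} {v' : n → ℂ} {x : ℝ}
    (hu : HasDerivAt u u' x) (hv : HasDerivAt v v' x) :
    HasDerivAt (fun t => u t ⬝ᵥ M *ᵥ v t) (u' ⬝ᵥ M *ᵥ v x + u x ⬝ᵥ M *ᵥ v') x := by
  have hu := hasDerivAt_pi.1 hu
  have hv := hasDerivAt_pi.1 hv
  simp only [dotProduct, mulVec, ← Finset.sum_add_distrib]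
  exact HasDerivAt.fun_sum fun i _ =>
    (hu i).mul (HasDerivAt.fun_sum fun j _ => (hv j).const_mul (M i j))

theorem Jmat_transpose (k : ℕ) : (Jmat k)ᵀ = (-1 : ℂ) ^ (k + 1) • Jmat k := by
  ext i j
  simp only [Jmat, transpose_apply, of_apply, Matrix.smul_apply, smul_eq_mul]
  by_cases h : (i : ℕ) + j + 1 = k
  · rw [if_pos (by omega), if_pos h, ← pow_add,
      show k + 1 + (i : ℕ) = j + 2 * (i + 1) by omega, pow_add, pow_mul]
    simp
  · rw [if_neg (by omega), if_neg h, mul_zero]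

theorem dotProduct_Jmat_mulVec_comm (k : ℕ) (u v : Fin k → ℂ) :
    u ⬝ᵥ Jmat k *ᵥ v = (-1 : ℂ) ^ (k + 1) * (v ⬝ᵥ Jmat k *ᵥ u) := by
  rw [dotProduct_mulVec, ← mulVec_transpose, dotProduct_comm, Jmat_transpose, smul_mulVec,
    dotProduct_smul, smul_eq_mul]

/-- let `ν : I → ℂ^k` be `k` times differentiable on a nonempty open
interval `I` (here `f i` denotes the `i`-th derivative `ν^{(i)}`, encoded by
`f 0 = ν` and `HasDerivAt (f i) (f (i+1) x) x` on `I`).  If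
`(ν^{(i)})ᵀ J_k ν^{(j)} = 0` on `I` whenever `i + j < k - 1` and
`(ν^{(i)})ᵀ J_k ν^{(j)} = (-1)^i` on `I` whenever `i + j = k - 1`, then
`(ν^{(i)})ᵀ J_k ν^{(j)} = 0` on `I` whenever `i + j = k`. -/
theorem pairing_vanishes_at_next_order (k : ℕ) (hk : 1 ≤ k)
    (I : Set ℝ) (hIopen : IsOpen I) (hIconn : I.OrdConnected) (hne : I.Nonempty)
    (ν : ℝ → Fin k → ℂ) (f : ℕ → ℝ → Fin k → ℂ) (hf0 : f 0 = ν)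
    (hderiv : ∀ i < k, ∀ x ∈ I, HasDerivAt (f i) (f (i + 1) x) x)
    (h0 : ∀ i j : ℕ, i + j + 1 < k → ∀ x ∈ I,
      f i x ⬝ᵥ (Jmat k).mulVec (f j x) = 0)
    (h1 : ∀ i j : ℕ, i + j + 1 = k → ∀ x ∈ I,
      f i x ⬝ᵥ (Jmat k).mulVec (f j x) = (-1 : ℂ) ^ i) :
    ∀ i j : ℕ, i + j = k → ∀ x ∈ I,
      f i x ⬝ᵥ (Jmat k).mulVec (f j x) = 0 := by
  intro i j hij x hx
  have step : ∀ i j : ℕ, i + j + 1 = k →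
      f (i + 1) x ⬝ᵥ Jmat k *ᵥ f j x = -(f i x ⬝ᵥ Jmat k *ᵥ f (j + 1) x) := by
    intro i j h
    have hd := (hderiv i (by omega) x hx).dotProduct_mulVec (M := Jmat k)
      (hderiv j (by omega) x hx)
    have hc : HasDerivAt (fun t => f i t ⬝ᵥ Jmat k *ᵥ f j t) 0 x :=
      (hasDerivAt_const x ((-1 : ℂ) ^ i)).congr_of_eventuallyEq
        (Filter.eventuallyEq_of_mem (hIopen.mem_nhds hx) (h1 i j h))
    exact eq_neg_of_add_eq_zero_left (hd.unique hc)
  have alternate : ∀ i j : ℕ, i + j = k →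
      f i x ⬝ᵥ Jmat k *ᵥ f j x = (-1 : ℂ) ^ i * (f 0 x ⬝ᵥ Jmat k *ᵥ f k x) := by
    intro i
    induction i with
    | zero =>
      rintro j rfl
      simp
    | succ i ih =>
      intro j h
      rw [step i j (by omega), ih (j + 1) (by omega), pow_succ]
      ring
  have first : f 0 x ⬝ᵥ Jmat k *ᵥ f k x = 0 := by
    have h := alternate k 0 (add_zero k)
    rw [dotProduct_Jmat_mulVec_comm, pow_succ] at h
    have hk0 : (-1 : ℂ) ^ k ≠ 0 := pow_ne_zero k (by norm_num)
    refine (mul_eq_zero.1 ?_).resolve_left hk0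
    linear_combination -h / 2
  rw [alternate i j hij, first, mul_zero]
end

section
/- Let k ≥ 1, and let B ∈ M_k(ℂ) be lower triangular with strictly positive real diagonal entries λ_1, …, λ_k, satisfying Bᵀ J_k B = J_k. Write B = ΛC where Λ = diag(λ_1,…,λ_k) is the diagonal part of B and C = Λ^{-1}B is unipotent lower-triangular. Then Cᵀ J_k C = J_k, Λᵀ J_k Λ = J_k, and λ_i λ_{k+1-i} = 1 for all 1 ≤ i ≤ k. -/
open Matrix

theorem Jmat_apply (k : ℕ) (i j : Fin k) :
    Jmat k i j = if j = i.rev then (-1 : ℂ) ^ (i : ℕ) else 0 := by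
  have h : (i : ℕ) + (j : ℕ) + 1 = k ↔ j = i.rev := by
    rw [Fin.ext_iff, Fin.val_rev]
    omega
  simp only [Jmat, Matrix.of_apply, h]

theorem transpose_mul_Jmat_mul_apply {k : ℕ} (B : Matrix (Fin k) (Fin k) ℂ) (i j : Fin k) :
    (Bᵀ * Jmat k * B) i j = ∑ a, B a i * (-1 : ℂ) ^ (a : ℕ) * B a.rev j := by
  rw [Matrix.mul_assoc, Matrix.mul_apply]
  simp [Matrix.mul_apply, Jmat_apply, mul_assoc]

/-- Opposite diagonal entries of a lower triangular matrix preserving `J_k` are inverse. -/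
theorem diag_mul_diag_rev_of_lowerTriangular {k : ℕ} {B : Matrix (Fin k) (Fin k) ℂ}
    (hBtri : ∀ i j : Fin k, i < j → B i j = 0) (hBJ : Bᵀ * Jmat k * B = Jmat k) (i : Fin k) :
    B i i * B i.rev i.rev = 1 := by
  have h := congrFun (congrFun hBJ i) i.rev
  rw [transpose_mul_Jmat_mul_apply, Jmat_apply, if_pos rfl,
    Finset.sum_eq_single_of_mem i (Finset.mem_univ i)] at h
  · have hp : (-1 : ℂ) ^ (i : ℕ) ≠ 0 := by simp
    apply mul_right_cancel₀ hp
    linear_combination h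
  · intro a _ ha
    rcases lt_or_gt_of_ne ha with ha | ha
    · simp [hBtri a i ha]
    · simp [hBtri a.rev i.rev (Fin.rev_lt_rev.mpr ha)]

theorem diagonal_transpose_mul_Jmat_mul_diagonal {k : ℕ} {d : Fin k → ℂ}
    (hd : ∀ i, d i * d i.rev = 1) :
    (Matrix.diagonal d)ᵀ * Jmat k * Matrix.diagonal d = Jmat k := by
  ext i j
  rw [Matrix.diagonal_transpose, Matrix.mul_diagonal, Matrix.diagonal_mul, Jmat_apply]
  split_ifs with h
  · subst h
    linear_combination (-1 : ℂ) ^ (i : ℕ) * hd i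
  · simp

/-- let `B` be lower triangular with strictly positive real diagonal
entries `λ_i = B i i`, satisfying `Bᵀ J_k B = J_k`.  Writing `B = ΛC` with
`Λ = diag(λ_1,…,λ_k)` and `C = Λ⁻¹ B` unipotent lower-triangular, we have
`Cᵀ J_k C = J_k`, `Λᵀ J_k Λ = J_k`, and `λ_i λ_{k+1-i} = 1` for all `i`. -/
theorem diagonal_and_unipotent_parts (k : ℕ) (hk : 1 ≤ k)
    (B : Matrix (Fin k) (Fin k) ℂ)
    (hBtri : ∀ i j : Fin k, i < j → B i j = 0)
    (hBdiag : ∀ i : Fin k, 0 < (B i i).re ∧ (B i i).im = 0)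
    (hBJ : Bᵀ * Jmat k * B = Jmat k) :
    ((Matrix.diagonal fun i => B i i)⁻¹ * B)ᵀ * Jmat k *
        ((Matrix.diagonal fun i => B i i)⁻¹ * B) = Jmat k ∧
    (Matrix.diagonal fun i => B i i)ᵀ * Jmat k * (Matrix.diagonal fun i => B i i)
        = Jmat k ∧
    ∀ i : Fin k, B i i * B i.rev i.rev = 1 := by
  have hrev := diag_mul_diag_rev_of_lowerTriangular hBtri hBJ
  refine ⟨?_, diagonal_transpose_mul_Jmat_mul_diagonal hrev, hrev⟩
  have hinv : (Matrix.diagonal fun i => B i i)⁻¹ = Matrix.diagonal fun i => B i.rev i.rev := by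
    apply Matrix.inv_eq_right_inv
    simp [Matrix.diagonal_mul_diagonal, hrev]
  have hJ := diagonal_transpose_mul_Jmat_mul_diagonal (d := fun i => B i.rev i.rev)
    fun i => hrev i.rev
  rw [hinv, Matrix.transpose_mul]
  calc Bᵀ * (Matrix.diagonal fun i => B i.rev i.rev)ᵀ * Jmat k *
        ((Matrix.diagonal fun i => B i.rev i.rev) * B)
      = Bᵀ * ((Matrix.diagonal fun i => B i.rev i.rev)ᵀ * Jmat k *
        (Matrix.diagonal fun i => B i.rev i.rev)) * B := by simp only [Matrix.mul_assoc]
    _ = Jmat k := by rw [hJ, hBJ]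
end

section
/- Let n ≥ 0 and let β_0, β_1, …, β_n be pairwise distinct real numbers with β_0 + β_1 + ⋯ + β_n = n(n+1)/2. For 0 ≤ i ≤ n set χ_i = ∏_{m=0}^{i−1} (β_i − β_m)^{−1} (so χ_0 = 1), and define f_i : (0,∞) → ℝ by f_i(x) = χ_i x^{β_i}. Then the Wronskian determinant det( f_i^{(j)}(x) )_{i,j=0}^{n} equals 1 for every x > 0. -/
/-- The `j`-th derivative of `y ↦ c * y ^ b` at `x > 0`, with the dependence on `c`, `b`, `x`
and on `j` separated. -/
lemma iteratedDeriv_const_mul_rpow (c b : ℝ) (j : ℕ) {x : ℝ} (hx : 0 < x) :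
    iteratedDeriv j (fun y : ℝ => c * y ^ b) x =
      (x ^ j)⁻¹ * ((c * x ^ b) * (descPochhammer ℝ j).eval b) := by
  rw [iteratedDeriv_const_mul_field, iteratedDeriv_eq_iterate, Real.iter_deriv_rpow_const,
    Real.rpow_sub_natCast hx.ne']
  field_simp

/-- The determinant of the falling factorials of `v` is the Vandermonde determinant. -/
lemma det_eval_descPochhammer {R : Type*} [CommRing R] [IsDomain R] {n : ℕ} (v : Fin n → R) :
    (Matrix.of fun i j : Fin n => (descPochhammer R j).eval (v i)).det =
      ∏ i : Fin n, ∏ j ∈ Finset.Ioi i, (v j - v i) := by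
  rw [← Matrix.det_vandermonde, Matrix.det_eval_matrixOfPolynomials_eq_det_vandermonde v
    (fun j => descPochhammer R j) (fun j => descPochhammer_natDegree R j)
    (fun j => monic_descPochhammer R j)]

lemma prod_fin_Ioi_eq_prod_range {M : Type*} [CommMonoid M] {n : ℕ} (f : ℕ → ℕ → M) :
    ∏ i : Fin n, ∏ j ∈ Finset.Ioi i, f j i =
      ∏ j : Fin n, ∏ m ∈ Finset.range (j : ℕ), f j m := by
  rw [Finset.prod_comm' (t' := Finset.univ) (s' := fun j => Finset.Iio j) (by simp)]
  refine Finset.prod_congr rfl fun j _ => ?_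
  refine Finset.prod_bij (fun i _ => (i : ℕ)) (by simp) (fun _ _ _ _ h => Fin.ext h) ?_ (by simp)
  intro m hm
  have hmj := Finset.mem_range.mp hm
  exact ⟨⟨m, hmj.trans j.isLt⟩, by simpa [Fin.lt_def] using hmj, rfl⟩

lemma prod_rpow_eq_prod_pow (n : ℕ) (β : ℕ → ℝ)
    (hsum : ∑ i ∈ Finset.range (n + 1), β i = (n : ℝ) * (n + 1) / 2) {x : ℝ} (hx : 0 < x) :
    ∏ i : Fin (n + 1), x ^ β i = ∏ j : Fin (n + 1), x ^ (j : ℕ) := by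
  have hid : ∑ i ∈ Finset.range (n + 1), (i : ℝ) = (n : ℝ) * (n + 1) / 2 := by
    have h := Finset.sum_range_id_mul_two (n + 1)
    rw [Nat.add_sub_cancel] at h
    have h' := congrArg (Nat.cast : ℕ → ℝ) h
    push_cast at h'
    linarith
  rw [Fin.prod_univ_eq_prod_range (fun i => x ^ β i), Fin.prod_univ_eq_prod_range (fun i => x ^ i),
    ← Real.rpow_sum_of_pos hx, hsum, ← hid, Real.rpow_sum_of_pos hx]
  simp

/-- let `β_0, …, β_n` be pairwise distinct reals summing to
`n(n+1)/2`, and set `χ_i = ∏_{m<i} (β_i − β_m)⁻¹`, `f_i(x) = χ_i x^{β_i}`.  Then the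
Wronskian determinant `det(f_i^{(j)}(x))_{i,j=0}^n` equals `1` for every `x > 0`. -/
theorem wronskian_of_powers_eq_one (n : ℕ) (β : ℕ → ℝ)
    (hdist : ∀ i ≤ n, ∀ j ≤ n, i ≠ j → β i ≠ β j)
    (hsum : ∑ i ∈ Finset.range (n + 1), β i = (n : ℝ) * (n + 1) / 2) :
    ∀ x : ℝ, 0 < x →
      Matrix.det (Matrix.of fun i j : Fin (n + 1) =>
        iteratedDeriv (j : ℕ)
          (fun y : ℝ =>
            (∏ m ∈ Finset.range (i : ℕ), (β (i : ℕ) - β m))⁻¹ * y ^ β (i : ℕ)) x)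
        = 1 := by
  intro x hx
  simp_rw [iteratedDeriv_const_mul_rpow _ _ _ hx]
  have hχ : ∏ i : Fin (n + 1), ∏ m ∈ Finset.range (i : ℕ), (β i - β m) ≠ 0 := by
    refine Finset.prod_ne_zero_iff.mpr fun i _ => Finset.prod_ne_zero_iff.mpr fun m hm => ?_
    have hmi := Finset.mem_range.mp hm
    have hi := i.isLt
    exact sub_ne_zero.mpr (hdist i (by omega) m (by omega) (by omega))
  have hpow : ∏ j : Fin (n + 1), x ^ (j : ℕ) ≠ 0 :=
    Finset.prod_ne_zero_iff.mpr fun j _ => pow_ne_zero _ hx.ne'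
  have hrow := Matrix.det_mul_row (fun j : Fin (n + 1) => (x ^ (j : ℕ))⁻¹)
    (Matrix.of fun i j : Fin (n + 1) =>
      (∏ m ∈ Finset.range (i : ℕ), (β i - β m))⁻¹ * x ^ β i * (descPochhammer ℝ j).eval (β i))
  have hcol := Matrix.det_mul_column
    (fun i : Fin (n + 1) => (∏ m ∈ Finset.range (i : ℕ), (β i - β m))⁻¹ * x ^ β i)
    (Matrix.of fun i j : Fin (n + 1) => (descPochhammer ℝ j).eval (β i))
  simp only [Matrix.of_apply] at hrow hcol
  rw [hrow, hcol, det_eval_descPochhammer (fun i : Fin (n + 1) => β i),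
    prod_fin_Ioi_eq_prod_range (fun j i => β j - β i), Finset.prod_mul_distrib,
    prod_rpow_eq_prod_pow n β hsum hx, Finset.prod_inv_distrib, Finset.prod_inv_distrib]
  field_simp
end

section
/- Let n ≥ 2. Let A^C = (a_{ij}) be the n×n Cartan matrix of type C_n: a_{ii} = 2; a_{i,i+1} = −1 for 1 ≤ i ≤ n−1; a_{i,i−1} = −1 for 2 ≤ i ≤ n−1; a_{n,n−1} = −2; all other entries 0. Let Ã = (ã_{ij}) be the (2n−1)×(2n−1) Cartan matrix of type A_{2n−1}: ã_{ii} = 2, ã_{i,i±1} = −1, all other entries 0. Let Ω ⊆ ℝ² be open and let u_1, …, u_n : Ω → ℝ be twice differentiable. Define ũ_i = u_{σ(i)} for 1 ≤ i ≤ 2n−1, where σ(i) = min(i, 2n−i). Then for every x ∈ Ω and every 1 ≤ i ≤ 2n−1, Δũ_i(x) + 4∑_{j=1}^{2n−1} ã_{ij} e^{ũ_j(x)} = Δu_{σ(i)}(x) + 4∑_{j=1}^{n} a_{σ(i)j} e^{u_j(x)}. Consequently, u_1,…,u_n satisfy Δu_i + 4∑_{j=1}^n a_{ij} e^{u_j}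 = 0 on Ω for all 1 ≤ i ≤ n if and only if ũ_1,…,ũ_{2n−1} satisfy Δũ_i + 4∑_{j=1}^{2n−1} ã_{ij} e^{ũ_j} = 0 on Ω for all 1 ≤ i ≤ 2n−1. -/
/-- The Laplace operator on `ℝ²`: `Δf = ∂²f/∂x₁² + ∂²f/∂x₂²`. -/
noncomputable def lap (f : ℝ × ℝ → ℝ) (p : ℝ × ℝ) : ℝ :=
  iteratedDeriv 2 (fun s => f (s, p.2)) p.1 + iteratedDeriv 2 (fun s => f (p.1, s)) p.2

/-- The Cartan matrix of type `A_m` (0-indexed entries). -/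
noncomputable def cartanA (m : ℕ) : Matrix (Fin m) (Fin m) ℝ :=
  Matrix.of fun i j =>
    if i = j then 2
    else if (j : ℕ) = (i : ℕ) + 1 ∨ (i : ℕ) = (j : ℕ) + 1 then -1
    else 0

/-- The Cartan matrix of type `C_n` (0-indexed entries): the entry in (1-indexed)
position `(n, n-1)` is `-2`, the other sub/super-diagonal entries are `-1`. -/
noncomputable def cartanC (n : ℕ) : Matrix (Fin n) (Fin n) ℝ :=
  Matrix.of fun i j =>
    if i = j then 2
    else if (j : ℕ) = (i : ℕ) + 1 then -1
    else if (i : ℕ) = (j : ℕ) + 1 then (if (i : ℕ) = n - 1 then -2 else -1)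
    else 0

/-- Summing a row of the Cartan matrix of type `A_{2n-1}` over a fibre of the folding map gives
the corresponding entry of the Cartan matrix of type `C_n`. -/
theorem sum_cartanA_fiber_eq_cartanC {n : ℕ} (hn : 2 ≤ n) (σ : Fin (2 * n - 1) → Fin n)
    (hσ : ∀ i, (σ i : ℕ) = min (i : ℕ) (2 * n - 2 - (i : ℕ)))
    (i : Fin (2 * n - 1)) (k : Fin n) :
    ∑ j with σ j = k, cartanA (2 * n - 1) i j = cartanC n (σ i) k := by
  have hi := i.isLt
  have hk := k.isLt
  have hσi := hσ i
  let a : Fin (2 * n - 1) := ⟨k, by omega⟩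
  let b : Fin (2 * n - 1) := ⟨2 * n - 2 - k, by omega⟩
  have hfiber : Finset.univ.filter (fun j => σ j = k) = {a, b} := by
    ext j
    have hj := j.isLt
    have hσj := hσ j
    simp only [Finset.mem_filter, Finset.mem_univ, true_and, Finset.mem_insert,
      Finset.mem_singleton, Fin.ext_iff, a, b]
    omega
  rw [hfiber]
  by_cases hkn : (k : ℕ) = n - 1
  · have hab : a = b := Fin.ext (by simp only [a, b]; omega)
    rw [← hab, Finset.pair_eq_singleton, Finset.sum_singleton]
    simp only [cartanA, cartanC, Matrix.of_apply, Fin.ext_iff, a]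
    split_ifs <;> first | rfl | omega
  · have hab : a ≠ b := by
      simp only [ne_eq, Fin.ext_iff, a, b]
      omega
    rw [Finset.sum_pair hab]
    simp only [cartanA, cartanC, Matrix.of_apply, Fin.ext_iff, a, b]
    split_ifs <;> first | omega | norm_num

/-- The folding identity for weighted row sums. -/
theorem sum_cartanA_mul_comp_eq_sum_cartanC_mul {n : ℕ} (hn : 2 ≤ n)
    (σ : Fin (2 * n - 1) → Fin n)
    (hσ : ∀ i, (σ i : ℕ) = min (i : ℕ) (2 * n - 2 - (i : ℕ)))
    (f : Fin n → ℝ) (i : Fin (2 * n - 1)) :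
    ∑ j, cartanA (2 * n - 1) i j * f (σ j) = ∑ k, cartanC n (σ i) k * f k := by
  rw [← Finset.sum_fiberwise Finset.univ σ]
  refine Finset.sum_congr rfl fun k _ => ?_
  rw [← sum_cartanA_fiber_eq_cartanC hn σ hσ i k, Finset.sum_mul]
  refine Finset.sum_congr rfl fun j hj => ?_
  rw [(Finset.mem_filter.mp hj).2]

/-- reduction of the `C_n` Toda system to the `A_{2n−1}` Toda system
with symmetry.  With `ũ_i = u_{σ(i)}`, `σ(i) = min(i, 2n−i)` (1-indexed; the
0-indexed version is `σ(i) = min(i, 2n−2−i)`), the `A_{2n−1}` Toda expression for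
`ũ` equals the `C_n` Toda expression for `u` at every point, and consequently `u`
solves the `C_n` system on `Ω` iff `ũ` solves the `A_{2n−1}` system on `Ω`. -/
theorem toda_C_reduction_to_A (n : ℕ) (hn : 2 ≤ n)
    (Ω : Set (ℝ × ℝ)) (hΩ : IsOpen Ω)
    (u : Fin n → ℝ × ℝ → ℝ)
    (hu : ∀ i, ContDiffOn ℝ 2 (u i) Ω)
    (σ : Fin (2 * n - 1) → Fin n)
    (hσ : ∀ i, (σ i : ℕ) = min (i : ℕ) (2 * n - 2 - (i : ℕ))) :
    (∀ p ∈ Ω, ∀ i : Fin (2 * n - 1),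
      lap (u (σ i)) p
          + 4 * ∑ j : Fin (2 * n - 1), cartanA (2 * n - 1) i j * Real.exp (u (σ j) p)
        = lap (u (σ i)) p
          + 4 * ∑ j : Fin n, cartanC n (σ i) j * Real.exp (u j p)) ∧
    ((∀ p ∈ Ω, ∀ i : Fin n,
        lap (u i) p + 4 * ∑ j : Fin n, cartanC n i j * Real.exp (u j p) = 0) ↔
     (∀ p ∈ Ω, ∀ i : Fin (2 * n - 1),
        lap (u (σ i)) p
          + 4 * ∑ j : Fin (2 * n - 1), cartanA (2 * n - 1) i j * Real.exp (u (σ j) p)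
          = 0)) := by
  have hfold (p : ℝ × ℝ) (i : Fin (2 * n - 1)) :=
    sum_cartanA_mul_comp_eq_sum_cartanC_mul hn σ hσ (fun k => Real.exp (u k p)) i
  have hsurj : Function.Surjective σ := fun k => by
    have hk := k.isLt
    refine ⟨⟨k, by omega⟩, Fin.ext ?_⟩
    rw [hσ]
    simp only
    omega
  refine ⟨fun p _ i => by rw [hfold], fun h p hp i => by rw [hfold]; exact h p hp (σ i),
    fun h p hp k => ?_⟩
  obtain ⟨i, rfl⟩ := hsurj k
  rw [← hfold]
  exact h p hp i
end

section
/- Let n ≥ 2. Let A^B = (a_{ij}) be the n×n Cartan matrix of type B_n: a_{ii} = 2; a_{i,i+1} = −1 for 1 ≤ i ≤ n−2; a_{n−1,n} = −2; a_{i,i−1} = −1 for 2 ≤ i ≤ n; all other entries 0. Let Ã = (ã_{ij}) be the 2n×2n Cartan matrix of type A_{2n}: ã_{ii} = 2, ã_{i,i±1} = −1, all other entries 0. Let Ω ⊆ ℝ² be open and let u_1, …, u_n : Ω → ℝ be twice differentiable. Define ũ_i = u_{σ(i)} + δ_{σ(i),n}·ln 2 for 1 ≤ i ≤ 2n, where σ(i)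 = min(i, 2n+1−i) and δ is the Kronecker delta. Then u_1,…,u_n satisfy Δu_i + 4∑_{j=1}^n a_{ij} e^{u_j} = 0 on Ω for all 1 ≤ i ≤ n if and only if ũ_1,…,ũ_{2n} satisfy Δũ_i + 4∑_{j=1}^{2n} ã_{ij} e^{ũ_j} = 0 on Ω for all 1 ≤ i ≤ 2n. -/
/-- The Cartan matrix of type `B_n` (0-indexed entries): the entry in (1-indexed)
position `(n-1, n)` is `-2`, the other sub/super-diagonal entries are `-1`. -/
noncomputable def cartanB (n : ℕ) : Matrix (Fin n) (Fin n) ℝ :=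
  Matrix.of fun i j =>
    if i = j then 2
    else if (j : ℕ) = (i : ℕ) + 1 then (if (j : ℕ) = n - 1 then -2 else -1)
    else if (i : ℕ) = (j : ℕ) + 1 then -1
    else 0

theorem lap_add_const (f : ℝ × ℝ → ℝ) (c : ℝ) (p : ℝ × ℝ) :
    lap (fun q => f q + c) p = lap f p := by
  simp [lap, iteratedDeriv_succ]

/-- A sum over `Fin m` against a tridiagonal coefficient has at most three terms. -/
theorem sum_tridiagonal (m : ℕ) (i : Fin m) (a b c : ℝ) (F : ℕ → ℝ) :
    ∑ j : Fin m, (if (i : ℕ) = j then a else if (j : ℕ) = i + 1 then b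
        else if (i : ℕ) = j + 1 then c else 0) * F j
      = a * F i + (if (i : ℕ) + 1 < m then b * F (i + 1) else 0)
        + (if 0 < (i : ℕ) then c * F (i - 1) else 0) := by
  have hi := i.isLt
  rw [Fin.sum_univ_eq_sum_range (fun j => (if (i : ℕ) = j then a else if j = i + 1 then b
        else if (i : ℕ) = j + 1 then c else 0) * F j) m]
  have key : ∀ j ∈ Finset.range m, (if (i : ℕ) = j then a else if j = i + 1 then b
        else if (i : ℕ) = j + 1 then c else 0) * F j
      = (if j = (i : ℕ) then a * F j else 0) + (if j = (i : ℕ) + 1 then b * F j else 0)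
        + (if j = (i : ℕ) - 1 then (if 0 < (i : ℕ) then c * F j else 0) else 0) := by
    intro j _
    grind
  rw [Finset.sum_congr rfl key, Finset.sum_add_distrib, Finset.sum_add_distrib]
  simp only [Finset.sum_ite_eq', Finset.mem_range]
  grind

theorem sum_cartanA_mul (m : ℕ) (i : Fin m) (F : ℕ → ℝ) :
    ∑ j : Fin m, cartanA m i j * F j
      = 2 * F i + (if (i : ℕ) + 1 < m then -1 * F (i + 1) else 0)
        + (if 0 < (i : ℕ) then -1 * F (i - 1) else 0) := by
  rw [← sum_tridiagonal]
  refine Finset.sum_congr rfl fun j _ => ?_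
  simp only [cartanA, Matrix.of_apply, Fin.ext_iff]
  grind

theorem sum_cartanB_mul (n : ℕ) (i : Fin n) (F : ℕ → ℝ) :
    ∑ j : Fin n, cartanB n i j * F j
      = 2 * F i + (if (i : ℕ) + 1 < n then
          (if (i : ℕ) + 1 = n - 1 then -2 else -1) * F (i + 1) else 0)
        + (if 0 < (i : ℕ) then -1 * F (i - 1) else 0) := by
  rw [← sum_tridiagonal]
  refine Finset.sum_congr rfl fun j _ => ?_
  simp only [cartanB, Matrix.of_apply, Fin.ext_iff]
  grind

/-- Folding the `A_{2n}` Cartan matrix along its diagram symmetry, with the middle values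
doubled, gives the `B_n` Cartan matrix. -/
theorem sum_cartanA_fold (n : ℕ) (hn : 2 ≤ n) (i : Fin (2 * n)) (k : Fin n)
    (hk : (k : ℕ) = min (i : ℕ) (2 * n - 1 - (i : ℕ))) (F : ℕ → ℝ) :
    ∑ j : Fin (2 * n), cartanA (2 * n) i j *
        (F (min (j : ℕ) (2 * n - 1 - (j : ℕ))) *
          (if min (j : ℕ) (2 * n - 1 - (j : ℕ)) = n - 1 then 2 else 1))
      = ∑ j : Fin n, cartanB n k j * F j := by
  rw [sum_cartanB_mul, sum_cartanA_mul (2 * n) i (fun j =>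
    F (min j (2 * n - 1 - j)) * (if min j (2 * n - 1 - j) = n - 1 then 2 else 1))]
  have hi := i.isLt
  generalize (k : ℕ) = k at *
  generalize (i : ℕ) = i at *
  rcases lt_or_ge i n with h | h
  · have e0 : min i (2 * n - 1 - i) = i := by omega
    have e2 : min (i - 1) (2 * n - 1 - (i - 1)) = i - 1 := by omega
    simp only [e0, e2] at hk ⊢
    subst hk
    rcases eq_or_ne k (n - 1) with h' | h'
    · have e1 : min (k + 1) (2 * n - 1 - (k + 1)) = k := by omega
      rw [e1]
      grind
    · have e1 : min (k + 1) (2 * n - 1 - (k + 1)) = k + 1 := by omega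
      rw [e1]
      grind
  · obtain ⟨l, hl⟩ : ∃ l, i + l + 1 = 2 * n := ⟨2 * n - 1 - i, by omega⟩
    have e0 : min i (2 * n - 1 - i) = l := by omega
    have e2 : 0 < l → min (i + 1) (2 * n - 1 - (i + 1)) = l - 1 := by omega
    rw [e0] at hk ⊢
    subst hk
    rcases eq_or_ne k (n - 1) with h' | h'
    · have e1 : min (i - 1) (2 * n - 1 - (i - 1)) = k := by omega
      rw [e1]
      grind
    · have e1 : min (i - 1) (2 * n - 1 - (i - 1)) = k + 1 := by omega
      rw [e1]
      grind

/-- reduction of the `B_n` Toda system to the `A_{2n}` Toda system with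
symmetry.  With `ũ_i = u_{σ(i)} + δ_{σ(i),n}·ln 2`, `σ(i) = min(i, 2n+1−i)`
(1-indexed; the 0-indexed version is `σ(i) = min(i, 2n−1−i)` and the Kronecker
condition reads `σ(i) = n−1`), `u` solves the `B_n` system on `Ω` iff `ũ` solves the
`A_{2n}` system on `Ω`. -/
theorem toda_B_reduction_to_A (n : ℕ) (hn : 2 ≤ n)
    (Ω : Set (ℝ × ℝ)) (hΩ : IsOpen Ω)
    (u : Fin n → ℝ × ℝ → ℝ)
    (hu : ∀ i, ContDiffOn ℝ 2 (u i) Ω)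
    (σ : Fin (2 * n) → Fin n)
    (hσ : ∀ i, (σ i : ℕ) = min (i : ℕ) (2 * n - 1 - (i : ℕ)))
    (ut : Fin (2 * n) → ℝ × ℝ → ℝ)
    (hut : ∀ i p, ut i p
      = u (σ i) p + (if (σ i : ℕ) = n - 1 then Real.log 2 else 0)) :
    (∀ p ∈ Ω, ∀ i : Fin n,
        lap (u i) p + 4 * ∑ j : Fin n, cartanB n i j * Real.exp (u j p) = 0) ↔
    (∀ p ∈ Ω, ∀ i : Fin (2 * n),
        lap (ut i) p
          + 4 * ∑ j : Fin (2 * n), cartanA (2 * n) i j * Real.exp (ut j p) = 0) := by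
  have hlap : ∀ i p, lap (ut i) p = lap (u (σ i)) p := fun i p => by
    rw [funext (hut i), lap_add_const]
  have hsum : ∀ i p, ∑ j : Fin (2 * n), cartanA (2 * n) i j * Real.exp (ut j p)
      = ∑ j : Fin n, cartanB n (σ i) j * Real.exp (u j p) := by
    intro i p
    let F : ℕ → ℝ := fun k => if h : k < n then Real.exp (u ⟨k, h⟩ p) else 0
    have hF : ∀ j : Fin n, F j = Real.exp (u j p) := fun j => by simp [F]
    simp only [← hF]
    rw [← sum_cartanA_fold n hn i (σ i) (hσ i) F]
    refine Finset.sum_congr rfl fun j _ => ?_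
    rw [← hσ j, hF, hut, Real.exp_add]
    split_ifs <;> simp [Real.exp_log]
  simp only [hlap, hsum]
  refine ⟨fun h p hp i => h p hp (σ i), fun h p hp k => ?_⟩
  have hk : σ ⟨k, by omega⟩ = k := by
    apply Fin.ext
    rw [hσ]
    simp only
    omega
  simpa only [hk] using h p hp ⟨k, by omega⟩
end

section
/- Let n ≥ 2. Let A^C = (a_{ij}) be the n×n Cartan matrix of type C_n: a_{ii} = 2; a_{i,i+1} = −1 for 1 ≤ i ≤ n−1; a_{i,i−1} = −1 for 2 ≤ i ≤ n−1; a_{n,n−1} = −2; all other entries 0. Let Ã = (ã_{ij}) be the (2n−1)×(2n−1) Cartan matrix of type A_{2n−1}: ã_{ii} = 2, ã_{i,i±1} = −1, all other entries 0. Suppose γ, α ∈ ℝ^n satisfy ∑_{j=1}^n a_{ij} α_j = γ_i for all 1 ≤ i ≤ n. Define γ̃, α̃ ∈ ℝ^{2n−1} by γ̃_i = γ_{σ(i)} and α̃_i = α_{σ(i)}, where σ(i) = min(i, 2n−i). Then ∑_{j=1}^{2n−1} ã_{ij} α̃_j = γ̃_i for all 1 ≤ i ≤ 2n−1. -/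
/-- A row of a tridiagonal matrix with diagonal entry `2`, superdiagonal entry `-1` and
subdiagonal entry `-c`, applied to a vector. -/
theorem sum_range_tridiagonal_row (m i : ℕ) (hi : i < m) (c : ℝ) (f : ℕ → ℝ) :
    ∑ j ∈ Finset.range m,
        (if i = j then 2 else if j = i + 1 then -1 else if i = j + 1 then -c else 0) * f j =
      2 * f i - (if i + 1 < m then f (i + 1) else 0) - (if 0 < i then c * f (i - 1) else 0) := by
  have split_entry : ∀ j ∈ Finset.range m,
      (if i = j then 2 else if j = i + 1 then -1 else if i = j + 1 then -c else 0) * f j =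
      (if i = j then 2 * f j else 0) - (if i + 1 = j then f j else 0)
        - (if i - 1 = j then (if 0 < i then c * f j else 0) else 0) := by
    intro j _
    split_ifs <;> first | omega | ring
  have hpred : i - 1 < m := by omega
  rw [Finset.sum_congr rfl split_entry, Finset.sum_sub_distrib, Finset.sum_sub_distrib]
  simp only [Finset.sum_ite_eq, Finset.mem_range, hi, hpred, if_true]

theorem sum_cartanA_row (m : ℕ) (i : Fin m) (f : ℕ → ℝ) :
    ∑ j : Fin m, cartanA m i j * f j =
      2 * f i - (if (i : ℕ) + 1 < m then f (i + 1) else 0)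
        - (if 0 < (i : ℕ) then f (i - 1) else 0) := by
  have key := sum_range_tridiagonal_row m i i.isLt 1 f
  rw [Finset.sum_range] at key
  simp only [one_mul] at key
  rw [← key]
  refine Finset.sum_congr rfl fun j _ => ?_
  simp only [cartanA, Matrix.of_apply, Fin.ext_iff]
  congr 1
  split_ifs <;> first | rfl | omega

theorem sum_cartanC_row (n : ℕ) (i : Fin n) (f : ℕ → ℝ) :
    ∑ j : Fin n, cartanC n i j * f j =
      2 * f i - (if (i : ℕ) + 1 < n then f (i + 1) else 0)
        - (if 0 < (i : ℕ) then (if (i : ℕ) = n - 1 then 2 else 1) * f (i - 1) else 0) := by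
  rw [← sum_range_tridiagonal_row n i i.isLt, Finset.sum_range]
  refine Finset.sum_congr rfl fun j _ => ?_
  simp only [cartanC, Matrix.of_apply, Fin.ext_iff]
  congr 1
  split_ifs <;> rfl

/-- if `A^C α = γ` for the Cartan matrix of type `C_n`, and
`γ̃_i = γ_{σ(i)}`, `α̃_i = α_{σ(i)}` with `σ(i) = min(i, 2n−i)` (1-indexed; 0-indexed
`σ(i) = min(i, 2n−2−i)`), then `Ã α̃ = γ̃` for the Cartan matrix of type
`A_{2n−1}`. -/
theorem toda_C_parameters_reduction (n : ℕ) (hn : 2 ≤ n)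
    (γ α : Fin n → ℝ)
    (h : ∀ i : Fin n, ∑ j : Fin n, cartanC n i j * α j = γ i)
    (σ : Fin (2 * n - 1) → Fin n)
    (hσ : ∀ i, (σ i : ℕ) = min (i : ℕ) (2 * n - 2 - (i : ℕ))) :
    ∀ i : Fin (2 * n - 1),
      ∑ j : Fin (2 * n - 1), cartanA (2 * n - 1) i j * α (σ j) = γ (σ i) := by
  obtain ⟨a, ha⟩ : ∃ a : ℕ → ℝ, ∀ j : Fin n, α j = a j :=
    ⟨fun k => if hk : k < n then α ⟨k, hk⟩ else 0, fun j => by simp⟩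
  intro i
  have hi := i.isLt
  rw [← h (σ i)]
  simp only [ha, hσ]
  rw [sum_cartanA_row (2 * n - 1) i fun k => a (min k (2 * n - 2 - k)),
    sum_cartanC_row n (σ i) a, hσ]
  rcases lt_trichotomy (i : ℕ) (n - 1) with hlt | heq | hgt
  · rw [show min (i : ℕ) (2 * n - 2 - i) = i by omega,
      show min ((i : ℕ) + 1) (2 * n - 2 - (i + 1)) = i + 1 by omega,
      show min ((i : ℕ) - 1) (2 * n - 2 - (i - 1)) = i - 1 by omega,
      if_pos (show (i : ℕ) + 1 < 2 * n - 1 by omega), if_pos (show (i : ℕ) + 1 < n by omega),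
      if_neg hlt.ne, one_mul]
  · rw [show min (i : ℕ) (2 * n - 2 - i) = i by omega,
      show min ((i : ℕ) + 1) (2 * n - 2 - (i + 1)) = i - 1 by omega,
      show min ((i : ℕ) - 1) (2 * n - 2 - (i - 1)) = i - 1 by omega,
      if_pos (by omega), if_pos (by omega), if_neg (by omega), if_pos (by omega), if_pos heq]
    ring
  · obtain ⟨k, hk⟩ : ∃ k, k = 2 * n - 2 - (i : ℕ) := ⟨_, rfl⟩
    rw [show min (i : ℕ) (2 * n - 2 - i) = k by omega,
      show min ((i : ℕ) + 1) (2 * n - 2 - (i + 1)) = k - 1 by omega,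
      show min ((i : ℕ) - 1) (2 * n - 2 - (i - 1)) = k + 1 by omega,
      if_pos (show 0 < (i : ℕ) by omega), if_pos (show k + 1 < n by omega),
      if_neg (show k ≠ n - 1 by omega), one_mul]
    by_cases hk0 : 0 < k
    · rw [if_pos (by omega), if_pos hk0]
      ring
    · rw [if_neg (by omega), if_neg hk0]
      ring
end

section
/- Let k ≥ 1 and let a_1 < a_2 < … < a_k be real numbers, and let M = (m_{ij}) ∈ M_k(ℂ). For 1 ≤ i ≤ k define g_i : (0,∞) × ℝ → ℂ by g_i(r,θ) = r^{a_i} (cos(a_i θ) + i·sin(a_i θ)). If ∑_{i,j=1}^{k} m_{ij} · conj(g_i(r,θ)) · g_j(r,θ) = 0 for all r ∈ (0,∞) and all θ ∈ ℝ, then M = 0. -/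
/-- The character `(t, θ) ↦ exp (s t + i d θ)` of the additive group `ℝ × ℝ`. -/
noncomputable def polarCharacter (p : ℝ × ℝ) : Multiplicative (ℝ × ℝ) →* ℂ where
  toFun x := Complex.exp ((p.1 * x.toAdd.1 : ℝ) + (p.2 * x.toAdd.2 : ℝ) * Complex.I)
  map_one' := by simp
  map_mul' x y := by
    rw [← Complex.exp_add]
    congr 1
    simp only [toAdd_mul, Prod.fst_add, Prod.snd_add]
    push_cast
    ring

theorem polarCharacter_ofAdd (p x : ℝ × ℝ) :
    polarCharacter p (Multiplicative.ofAdd x) =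
      Complex.exp ((p.1 * x.1 : ℝ) + (p.2 * x.2 : ℝ) * Complex.I) :=
  rfl

theorem polarCharacter_injective : Function.Injective polarCharacter := by
  rintro ⟨s, d⟩ ⟨s', d'⟩ hpq
  have key (x : ℝ × ℝ) := DFunLike.congr_fun hpq (Multiplicative.ofAdd x)
  simp only [polarCharacter_ofAdd] at key
  have hs : s = s' := by
    have := congrArg norm (key (1, 0))
    simpa [Complex.norm_exp] using this
  have hd : d = d' := by
    by_contra hne
    have hsub : d - d' ≠ 0 := sub_ne_zero.mpr hne
    have hexp := key (0, Real.pi / (d - d'))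
    have hsplit : d * (Real.pi / (d - d')) = d' * (Real.pi / (d - d')) + Real.pi := by
      field_simp
      ring
    rw [hsplit] at hexp
    simp only [mul_zero, Complex.ofReal_zero, zero_add, Complex.ofReal_add, add_mul,
      Complex.exp_add, Complex.exp_pi_mul_I, mul_neg, mul_one] at hexp
    exact Complex.exp_ne_zero _ (self_eq_neg.mp hexp.symm)
  rw [hs, hd]

theorem linearIndependent_polarCharacter :
    LinearIndependent ℂ (fun p => (polarCharacter p : Multiplicative (ℝ × ℝ) → ℂ)) :=
  (linearIndependent_monoidHom (Multiplicative (ℝ × ℝ)) ℂ).comp _ polarCharacter_injective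

theorem exp_rpow_mul_cos_add_sin (t b θ : ℝ) :
    ((Real.exp t ^ b : ℝ) : ℂ) *
        ((Real.cos (b * θ) : ℂ) + (Real.sin (b * θ) : ℂ) * Complex.I) =
      Complex.exp ((b * t : ℝ) + (b * θ : ℝ) * Complex.I) := by
  rw [Complex.exp_add, Complex.exp_mul_I, ← Real.exp_mul, mul_comm t b, Complex.ofReal_exp,
    Complex.ofReal_cos, Complex.ofReal_sin]

theorem conj_exp_mul_exp (t θ b c : ℝ) :
    (starRingEnd ℂ) (Complex.exp ((b * t : ℝ) + (b * θ : ℝ) * Complex.I)) *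
        Complex.exp ((c * t : ℝ) + (c * θ : ℝ) * Complex.I) =
      polarCharacter (b + c, c - b) (Multiplicative.ofAdd (t, θ)) := by
  rw [polarCharacter_ofAdd, ← Complex.exp_conj, ← Complex.exp_add]
  congr 1
  simp only [map_add, map_mul, Complex.conj_ofReal, Complex.conj_I]
  push_cast
  ring


/-- linear independence of the functions
`g_i(r,θ) = r^{a_i}(cos(a_iθ) + i sin(a_iθ))` for strictly increasing real exponents
`a_1 < ⋯ < a_k`: if `∑_{i,j} m_{ij} conj(g_i) g_j = 0` for all `r > 0` and all
`θ ∈ ℝ`, then the coefficient matrix `M` vanishes. -/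
theorem coefficient_matrix_vanishes (k : ℕ) (hk : 1 ≤ k)
    (a : Fin k → ℝ) (ha : StrictMono a)
    (M : Matrix (Fin k) (Fin k) ℂ)
    (h : ∀ r : ℝ, 0 < r → ∀ θ : ℝ,
      ∑ i : Fin k, ∑ j : Fin k, M i j *
          (starRingEnd ℂ)
            (((r ^ a i : ℝ) : ℂ) *
              ((Real.cos (a i * θ) : ℂ) + (Real.sin (a i * θ) : ℂ) * Complex.I)) *
          (((r ^ a j : ℝ) : ℂ) *
            ((Real.cos (a j * θ) : ℂ) + (Real.sin (a j * θ) : ℂ) * Complex.I))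
        = 0) :
    M = 0 := by
  have hinj : Function.Injective
      fun p : Fin k × Fin k => (a p.1 + a p.2, a p.2 - a p.1) := by
    rintro ⟨i, j⟩ ⟨i', j'⟩ hp
    obtain ⟨hadd, hsub⟩ := Prod.mk.inj hp
    dsimp only at hadd hsub
    exact Prod.ext (ha.injective (by linarith)) (ha.injective (by linarith))
  have hli := Fintype.linearIndependent_iff.mp (linearIndependent_polarCharacter.comp _ hinj)
  ext i j
  refine hli (fun p => M p.1 p.2) ?_ (i, j)
  ext x
  have hx := h (Real.exp x.toAdd.1) (Real.exp_pos _) x.toAdd.2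
  simp only [exp_rpow_mul_cos_add_sin, mul_assoc, conj_exp_mul_exp] at hx
  simpa [Fintype.sum_prod_type] using hx
end
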